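/- Let $n,k\in\mathbb{N}$ with $k\ge 1$. Let $\mathbb{S}^n$ be the space of real symmetric $n\times n$ matrices with inner product $Y\bullet X=\operatorname{tr}(YX)$; for $K\subseteq\mathbb{S}^n$ let $K^*=\{Y\in\mathbb{S}^n : Y\bullet X\ge 0 \text{ for all } X\in K\}$. Let $\|x\|_0$ be the number of nonzero entries of $x\in\mathbb{R}^n$, let $\operatorname{diag}(X)$ be the diagonal matrix with the same diagonal as $X$, and for $S\subseteq[n]$ let $Y_S$ be the principal submatrix of $Y$ indexed by $S$. Put $$Q_{n,k}=\{xx^T : x\in\mathbb{R}^n,\ \|x\|_0\le k\},\qquad D_{n,k}=\{Y\in\mathbb{S}^n : Y_S\succeq 0 \text{ for every } S\subseteq[n] \text{ with } |S|\le k\},$$ $$\mathcal{S}_{n,k}=\{X\in\mathbb{S}^n : k\operatorname{diag}(X)\succeq X\succeq 0\},\qquad \mathcal{S}^{\ell_1}_{n,k}=\Big\{X\in\mathbb{S}^n : \sum_{i,j}|X_{ij}|\le k\operatorname{tr}X,\ X\succeq 0\Big\}.$$ A nonzero element $X$ of a convex cone $K$ is an extreme ray of $K$ if, whenever $X=X_1+X_2$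 with $X_1,X_2\in K$, both $X_1$ and $X_2$ are nonnegative multiples of $X$. Then $\operatorname{conv}(Q_{n,k})^*=D_{n,k}$. Moreover, if $k\ge 2$ or $n=1$, then for every nonzero $x\in\mathbb{R}^n$ with $\|x\|_0\le k$ the matrix $X=xx^T$ is an extreme ray of each of the cones $D_{n,k}=\operatorname{conv}(Q_{n,k})^*$, $(\mathcal{S}_{n,k})^*$ and $(\mathcal{S}^{\ell_1}_{n,k})^*$. -/

import Mathlib

/-- Number of nonzero entries `‖x‖₀` of a vector. -/
noncomputable def sparsity {n : ℕ} (x : Fin n → ℝ) : ℕ :=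
  (Finset.univ.filter fun i => x i ≠ 0).card

/-- `Q_{n,k}`: the set of matrices `x xᵀ` with `‖x‖₀ ≤ k`. -/
def Qset (n k : ℕ) : Set (Matrix (Fin n) (Fin n) ℝ) :=
  {X | ∃ x : Fin n → ℝ, sparsity x ≤ k ∧ X = Matrix.vecMulVec x x}

/-- The `k`-spartrahedron: symmetric matrices with `k·diag(X) ⪰ X ⪰ 0`. -/
def Spartra (n k : ℕ) : Set (Matrix (Fin n) (Fin n) ℝ) :=
  {X | ((k : ℝ) • Matrix.diagonal (fun i => X i i) - X).PosSemidef ∧ X.PosSemidef}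

/-- The `ℓ₁` relaxation: symmetric matrices with `‖X‖₁ ≤ k·tr X` and `X ⪰ 0`, where `‖X‖₁` is the
sum of the absolute values of all entries. -/
def SpartraOne (n k : ℕ) : Set (Matrix (Fin n) (Fin n) ℝ) :=
  {X | (∑ i, ∑ j, |X i j|) ≤ (k : ℝ) * X.trace ∧ X.PosSemidef}

/-- The dual cone, in the space of symmetric matrices with the trace inner product
`Y • X = tr(Y X)`, of a set of symmetric matrices. -/
def symDualCone {n : ℕ} (K : Set (Matrix (Fin n) (Fin n) ℝ)) : Set (Matrix (Fin n) (Fin n) ℝ) :=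
  {Y | Y.IsSymm ∧ ∀ X ∈ K, 0 ≤ (Y * X).trace}

/-- `D_{n,k}`: symmetric matrices all of whose principal submatrices of size at most `k` are
positive semidefinite. -/
def Dcone (n k : ℕ) : Set (Matrix (Fin n) (Fin n) ℝ) :=
  {Y | Y.IsSymm ∧ ∀ S : Finset (Fin n), S.card ≤ k →
    (Y.submatrix (fun i : S => (i : Fin n)) (fun i : S => (i : Fin n))).PosSemidef}

/-- `X` spans an extreme ray of the convex cone `K`: `X` is a nonzero element of `K`
and whenever `X = X₁ + X₂` with `X₁, X₂ ∈ K`, both summands are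
nonnegative multiples of `X`. -/
def IsExtremeRay {E : Type*} [AddCommMonoid E] [Module ℝ E] (K : Set E) (X : E) : Prop :=
  X ≠ 0 ∧ X ∈ K ∧ ∀ X₁ X₂, X₁ ∈ K → X₂ ∈ K → X = X₁ + X₂ →
    (∃ c₁ : ℝ, 0 ≤ c₁ ∧ X₁ = c₁ • X) ∧ (∃ c₂ : ℝ, 0 ≤ c₂ ∧ X₂ = c₂ • X)

open Matrix Finset

section SparseForms

variable {n k : ℕ}

theorem trace_mul_vecMulVec_self (Y : Matrix (Fin n) (Fin n) ℝ) (v : Fin n → ℝ) :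
    (Y * vecMulVec v v).trace = v ⬝ᵥ Y *ᵥ v := by
  rw [mul_vecMulVec, trace_vecMulVec, dotProduct_comm]

/-- A quadratic form only sees the principal submatrix on a set containing the support. -/
theorem dotProduct_submatrix_mulVec_of_support (Y : Matrix (Fin n) (Fin n) ℝ) (S : Finset (Fin n))
    (v : Fin n → ℝ) (hv : ∀ i, i ∉ S → v i = 0) :
    (fun i : S => v i) ⬝ᵥ
      (Y.submatrix (fun i : S => (i : Fin n)) (fun i : S => (i : Fin n))) *ᵥ (fun i : S => v i) =
      v ⬝ᵥ Y *ᵥ v := by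
  simp only [dotProduct, mulVec, submatrix_apply]
  have inner : ∀ i, ∑ j : S, Y i j * v j = ∑ j, Y i j * v j := fun i => by
    rw [Finset.sum_coe_sort S (fun j => Y i j * v j)]
    exact Finset.sum_subset (Finset.subset_univ S) fun j _ hj => by simp [hv j hj]
  simp only [inner]
  rw [Finset.sum_coe_sort S (fun i => v i * ∑ j, Y i j * v j)]
  exact Finset.sum_subset (Finset.subset_univ S) fun j _ hj => by simp [hv j hj]

theorem sparsity_le_card_of_support {v : Fin n → ℝ} {S : Finset (Fin n)}
    (hv : ∀ i, i ∉ S → v i = 0) : sparsity v ≤ S.card :=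
  Finset.card_le_card fun i hi => by
    by_contra h
    exact (Finset.mem_filter.1 hi).2 (hv i h)

/-- `D_{n,k}` consists of the symmetric matrices whose quadratic form is nonnegative on all
`k`-sparse vectors. -/
theorem mem_Dcone_iff_forall_sparse {Y : Matrix (Fin n) (Fin n) ℝ} :
    Y ∈ Dcone n k ↔ Y.IsSymm ∧ ∀ v : Fin n → ℝ, sparsity v ≤ k → 0 ≤ v ⬝ᵥ Y *ᵥ v := by
  refine and_congr_right fun hY => ⟨fun h v hv => ?_, fun h S hS => ?_⟩
  · rw [← dotProduct_submatrix_mulVec_of_support Y (univ.filter fun i => v i ≠ 0) v (by simp)]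
    simpa using (h _ hv).dotProduct_mulVec_nonneg _
  · refine PosSemidef.of_dotProduct_mulVec_nonneg ?_ fun u => ?_
    · ext i j
      simpa using hY.apply i j
    · have hv : ∀ i, i ∉ S → (fun i => if h : i ∈ S then u ⟨i, h⟩ else 0) i = 0 :=
        fun i hi => by simp [hi]
      have hu : (fun i : S => (fun i => if h : i ∈ S then u ⟨i, h⟩ else 0) (i : Fin n)) = u := by
        ext i; simp
      have := h _ ((sparsity_le_card_of_support hv).trans hS)
      rw [← dotProduct_submatrix_mulVec_of_support Y S _ hv, hu] at this
      simpa using this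

/-- The dual cone of the convex hull of `Q_{n,k}` is `D_{n,k}`. -/
theorem symDualCone_convexHull_Qset (n k : ℕ) :
    symDualCone (convexHull ℝ (Qset n k)) = Dcone n k := by
  ext Y
  rw [mem_Dcone_iff_forall_sparse]
  refine and_congr_right fun _ => ⟨fun h v hv => ?_, fun h => ?_⟩
  · rw [← trace_mul_vecMulVec_self]
    exact h _ (subset_convexHull ℝ _ ⟨v, hv, rfl⟩)
  · have hconv : Convex ℝ {X : Matrix (Fin n) (Fin n) ℝ | 0 ≤ (Y * X).trace} := by
      intro A hA B hB a b ha hb _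
      simp only [Set.mem_ofPred_eq] at hA hB ⊢
      rw [Matrix.mul_add, Matrix.mul_smul, Matrix.mul_smul, trace_add, trace_smul, trace_smul,
        smul_eq_mul, smul_eq_mul]
      positivity
    refine fun X hX => convexHull_min ?_ hconv hX
    rintro _ ⟨v, hv, rfl⟩
    simpa only [Set.mem_ofPred_eq, trace_mul_vecMulVec_self] using h v hv

/-- Cauchy–Schwarz on the support of a sparse vector. -/
theorem sq_sum_le_mul_sum_sq_of_sparsity {x f : Fin n → ℝ} (hx : sparsity x ≤ k)
    (hf : ∀ i, x i = 0 → f i = 0) : (∑ i, f i) ^ 2 ≤ k * ∑ i, f i ^ 2 := by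
  have hsum : ∑ i ∈ univ.filter (fun i => x i ≠ 0), f i = ∑ i, f i :=
    Finset.sum_subset (Finset.filter_subset _ _) fun i _ hi => hf i (by simpa using hi)
  have hcs := sq_sum_le_card_mul_sum_sq (s := univ.filter fun i => x i ≠ 0) (f := f)
  rw [hsum] at hcs
  refine hcs.trans (mul_le_mul (by exact_mod_cast hx) ?_ (by positivity) (by positivity))
  exact Finset.sum_le_sum_of_subset_of_nonneg (Finset.filter_subset _ _) fun _ _ _ => sq_nonneg _

theorem vecMulVec_self_posSemidef (x : Fin n → ℝ) : (vecMulVec x x).PosSemidef := by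
  simpa using posSemidef_vecMulVec_self_star x

theorem dotProduct_vecMulVec_mulVec (x v : Fin n → ℝ) :
    v ⬝ᵥ vecMulVec x x *ᵥ v = (∑ i, x i * v i) ^ 2 := by
  rw [vecMulVec_mulVec]
  simp only [dotProduct, Pi.smul_apply, MulOpposite.smul_eq_mul_unop, MulOpposite.unop_op, sq]
  rw [Finset.sum_mul]
  exact Finset.sum_congr rfl fun i _ => by ring

theorem Qset_subset_Spartra (n k : ℕ) : Qset n k ⊆ Spartra n k := by
  rintro _ ⟨x, hx, rfl⟩
  refine ⟨PosSemidef.of_dotProduct_mulVec_nonneg ?_ fun v => ?_, vecMulVec_self_posSemidef x⟩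
  · refine IsHermitian.sub ?_ (vecMulVec_self_posSemidef x).1
    rw [← diagonal_smul]
    exact isHermitian_diagonal _
  · have h := sq_sum_le_mul_sum_sq_of_sparsity (f := fun i => x i * v i) hx fun i hi => by simp [hi]
    have hd : v ⬝ᵥ ((k : ℝ) • diagonal (fun i => vecMulVec x x i i)) *ᵥ v =
        k * ∑ i, (x i * v i) ^ 2 := by
      rw [smul_mulVec, dotProduct_smul, smul_eq_mul]
      congr 1
      simp only [dotProduct, mulVec_diagonal, vecMulVec_apply]
      exact Finset.sum_congr rfl fun i _ => by ring
    rw [star_trivial, sub_mulVec, dotProduct_sub, hd, dotProduct_vecMulVec_mulVec]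
    linarith

theorem Qset_subset_SpartraOne (n k : ℕ) : Qset n k ⊆ SpartraOne n k := by
  rintro _ ⟨x, hx, rfl⟩
  refine ⟨?_, vecMulVec_self_posSemidef x⟩
  have h := sq_sum_le_mul_sum_sq_of_sparsity (f := fun i => |x i|) hx fun i hi => by simp [hi]
  have hl : ∑ i, ∑ j, |vecMulVec x x i j| = (∑ i, |x i|) ^ 2 := by
    simp only [vecMulVec_apply, abs_mul, sq, Finset.sum_mul_sum]
  have hr : (vecMulVec x x).trace = ∑ i, |x i| ^ 2 := by
    simp only [trace, diag_apply, vecMulVec_apply, sq, abs_mul_abs_self]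
  rwa [hl, hr]

/-- The dual of a set containing `Q_{n,k}` is contained in `D_{n,k}`. -/
theorem symDualCone_subset_Dcone {K : Set (Matrix (Fin n) (Fin n) ℝ)} (hK : Qset n k ⊆ K) :
    symDualCone K ⊆ Dcone n k := fun Y hY =>
  mem_Dcone_iff_forall_sparse.2 ⟨hY.1, fun v hv => by
    rw [← trace_mul_vecMulVec_self]
    exact hY.2 _ (hK ⟨v, hv, rfl⟩)⟩

theorem vecMulVec_self_mem_symDualCone {K : Set (Matrix (Fin n) (Fin n) ℝ)}
    (hK : ∀ X ∈ K, X.PosSemidef) (x : Fin n → ℝ) : vecMulVec x x ∈ symDualCone K := by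
  refine ⟨transpose_vecMulVec x x, fun X hX => ?_⟩
  rw [trace_mul_comm, trace_mul_vecMulVec_self]
  simpa using (hK X hX).dotProduct_mulVec_nonneg x

theorem vecMulVec_self_mem_Dcone (x : Fin n → ℝ) : vecMulVec x x ∈ Dcone n k :=
  mem_Dcone_iff_forall_sparse.2 ⟨transpose_vecMulVec x x, fun v _ => by
    rw [dotProduct_vecMulVec_mulVec]; positivity⟩

end SparseForms

section Extremality

/-- A zero of a nonnegative binary quadratic form is a critical point of it. -/
theorem binary_form_kernel {a b d s t : ℝ}
    (h : ∀ s t : ℝ, 0 ≤ a * s ^ 2 + 2 * b * (s * t) + d * t ^ 2)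
    (h0 : a * s ^ 2 + 2 * b * (s * t) + d * t ^ 2 = 0) : a * s + b * t = 0 := by
  have ha : 0 ≤ a := by simpa using h 1 0
  have h1 := h ((a + 1) * s - (a * s + b * t)) ((a + 1) * t)
  have h2 : (a + 2) * (a * s + b * t) ^ 2 ≤ 0 := by
    linear_combination h1 + (a + 1) ^ 2 * h0
  have h3 : (a * s + b * t) ^ 2 ≤ 0 := by
    by_contra hc
    push Not at hc
    have : 0 < (a + 2) * (a * s + b * t) ^ 2 := by positivity
    linarith
  exact pow_eq_zero_iff two_ne_zero |>.1 (le_antisymm h3 (sq_nonneg _))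

variable {n k : ℕ}

theorem dotProduct_mulVec_single_add_single {Y : Matrix (Fin n) (Fin n) ℝ} (hY : Y.IsSymm)
    (i j : Fin n) (s t : ℝ) :
    (Pi.single i s + Pi.single j t : Fin n → ℝ) ⬝ᵥ Y *ᵥ (Pi.single i s + Pi.single j t) =
      Y i i * s ^ 2 + 2 * Y i j * (s * t) + Y j j * t ^ 2 := by
  have := hY.apply i j
  simp only [mulVec_add, add_dotProduct, dotProduct_add, single_dotProduct, mulVec_single,
    Pi.smul_apply, MulOpposite.smul_eq_mul_unop, MulOpposite.unop_op, col_apply, this]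
  ring

theorem sparsity_single_add_single_le (hkn : 2 ≤ k ∨ n ≤ k) (i j : Fin n) (s t : ℝ) :
    sparsity (Pi.single i s + Pi.single j t : Fin n → ℝ) ≤ k := by
  rcases hkn with hk | hk
  · refine (sparsity_le_card_of_support (S := {i, j}) fun l hl => ?_).trans
      (Finset.card_le_two.trans hk)
    simp only [Finset.mem_insert, Finset.mem_singleton, not_or] at hl
    simp [hl.1, hl.2]
  · exact (Finset.card_le_univ _).trans (by simpa using hk)

/-- The `2 × 2` principal minors of a member of `D_{n,k}` are nonnegative forms. -/
theorem binary_form_nonneg_of_mem_Dcone (hkn : 2 ≤ k ∨ n ≤ k) {Y : Matrix (Fin n) (Fin n) ℝ}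
    (hY : Y ∈ Dcone n k) (i j : Fin n) (s t : ℝ) :
    0 ≤ Y i i * s ^ 2 + 2 * Y i j * (s * t) + Y j j * t ^ 2 := by
  rw [mem_Dcone_iff_forall_sparse] at hY
  rw [← dotProduct_mulVec_single_add_single hY.1]
  exact hY.2 _ (sparsity_single_add_single_le hkn i j s t)

/-- A summand in `D_{n,k}` of `x xᵀ` is a nonnegative multiple of `x xᵀ`. -/
theorem exists_smul_of_vecMulVec_eq_add (hkn : 2 ≤ k ∨ n ≤ k) {x : Fin n → ℝ} (hx : x ≠ 0)
    {Y Z : Matrix (Fin n) (Fin n) ℝ} (hY : Y ∈ Dcone n k) (hZ : Z ∈ Dcone n k)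
    (h : vecMulVec x x = Y + Z) : ∃ c : ℝ, 0 ≤ c ∧ Y = c • vecMulVec x x := by
  have hform := binary_form_nonneg_of_mem_Dcone hkn hY
  have hsum : ∀ i j, Y i j + Z i j = x i * x j := fun i j => by
    rw [← Matrix.add_apply, ← h, vecMulVec_apply]
  have hker : ∀ i j, Y i i * x j = Y i j * x i := fun i j => by
    have h0 : Y i i * x j ^ 2 + 2 * Y i j * (x j * -x i) + Y j j * (-x i) ^ 2 = 0 := by
      refine le_antisymm ?_ (hform i j _ _)
      have hz := binary_form_nonneg_of_mem_Dcone hkn hZ i j (x j) (-x i)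
      linear_combination hz + x j ^ 2 * hsum i i - 2 * x i * x j * hsum i j +
        x i ^ 2 * hsum j j
    linear_combination binary_form_kernel (hform i j) h0
  obtain ⟨p, hp⟩ : ∃ p, x p ≠ 0 := Function.ne_iff.1 hx
  have hdiag : ∀ i, Y i i = Y p p / x p ^ 2 * x i ^ 2 := fun i => by
    have hs := hY.1.apply i p
    have : Y i i * x p ^ 2 = Y p p * x i ^ 2 := by
      linear_combination x p * hker i p - x i * hker p i - x i * x p * hs
    field_simp
    linear_combination this
  refine ⟨Y p p / x p ^ 2, div_nonneg (by simpa using hform p p 1 0) (sq_nonneg _), ?_⟩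
  ext i j
  rw [Matrix.smul_apply, vecMulVec_apply, smul_eq_mul]
  by_cases hi : x i = 0
  · have hii : Y i i = 0 := by rw [hdiag, hi]; ring
    have hji := binary_form_kernel (hform j i) (s := 0) (t := 1) (by rw [hii]; ring)
    rw [hi, ← hY.1.apply i j]
    linear_combination hji
  · refine mul_right_cancel₀ hi ?_
    linear_combination x j * hdiag i - hker i j

theorem IsExtremeRay.mono {E : Type*} [AddCommMonoid E] [Module ℝ E] {K L : Set E} {X : E}
    (h : IsExtremeRay L X) (hKL : K ⊆ L) (hX : X ∈ K) : IsExtremeRay K X :=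
  ⟨h.1, hX, fun X₁ X₂ h₁ h₂ => h.2.2 X₁ X₂ (hKL h₁) (hKL h₂)⟩

theorem isExtremeRay_Dcone_vecMulVec (hkn : 2 ≤ k ∨ n ≤ k) {x : Fin n → ℝ} (hx : x ≠ 0) :
    IsExtremeRay (Dcone n k) (vecMulVec x x) := by
  refine ⟨?_, vecMulVec_self_mem_Dcone x, fun X₁ X₂ h₁ h₂ h =>
    ⟨exists_smul_of_vecMulVec_eq_add hkn hx h₁ h₂ h,
      exists_smul_of_vecMulVec_eq_add hkn hx h₂ h₁ (h.trans (add_comm _ _))⟩⟩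
  obtain ⟨p, hp⟩ : ∃ p, x p ≠ 0 := Function.ne_iff.1 hx
  intro h
  have := congrFun (congrFun h p) p
  simp [vecMulVec_apply, hp] at this

end Extremality

theorem rank_one_extreme_ray_dual (n k : ℕ) (hk : 1 ≤ k) :
    symDualCone (convexHull ℝ (Qset n k)) = Dcone n k ∧
    ((2 ≤ k ∨ n = 1) → ∀ x : Fin n → ℝ, x ≠ 0 → sparsity x ≤ k →
      IsExtremeRay (Dcone n k) (Matrix.vecMulVec x x) ∧
      IsExtremeRay (symDualCone (Spartra n k)) (Matrix.vecMulVec x x) ∧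
      IsExtremeRay (symDualCone (SpartraOne n k)) (Matrix.vecMulVec x x)) := by
  refine ⟨symDualCone_convexHull_Qset n k, fun hkn x hx _ => ?_⟩
  have hD : IsExtremeRay (Dcone n k) (vecMulVec x x) :=
    isExtremeRay_Dcone_vecMulVec (hkn.imp_right fun h => h.trans_le hk) hx
  exact ⟨hD,
    hD.mono (symDualCone_subset_Dcone (Qset_subset_Spartra n k))
      (vecMulVec_self_mem_symDualCone (fun _ hX => hX.2) x),
    hD.mono (symDualCone_subset_Dcone (Qset_subset_SpartraOne n k))
      (vecMulVec_self_mem_symDualCone (fun _ hX => hX.2) x)⟩
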